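/- Suppose δ < (d−1)/(d+1) and β < 2δ/(d(d−1)) + (d−2)/d. Let Ĥ(A) = { Ψ ⊆ [n] : |Ψ| = d and every pair of distinct vertices of Ψ is an edge of A } be the clique estimator. Then for every sequence p_n ∈ [0,1] with q_n ≤ p_n, the false-positive probability satisfies max over d-subsets Ψ of [n] of ℙ( Ψ ∈ Ĥ(A) | Ψ ∉ H ) = o(s_n) as n → ∞. -/

import Mathlib

open Finset Filter
open scoped Classical symmDiff

noncomputable section

namespace NoisyHypergraph

/-- The set of unordered pairs of distinct vertices of `[n]`, encoded as 2-element subsets. -/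
def pairs (n : ℕ) : Finset (Finset (Fin n)) :=
  (Finset.univ : Finset (Fin n)).powersetCard 2

/-- The set of `d`-element subsets of `[n]` (potential hyperedges). -/
def dsets (n d : ℕ) : Finset (Finset (Fin n)) :=
  (Finset.univ : Finset (Fin n)).powersetCard d

/-- Projection of a hypergraph: all pairs of distinct vertices contained in some hyperedge. -/
def proj (n : ℕ) (H : Finset (Finset (Fin n))) : Finset (Finset (Fin n)) :=
  (pairs n).filter fun e => ∃ Ψ ∈ H, e ⊆ Ψ

/-- Mass function of `μ_{n,d,s}`: each `d`-subset included independently with probability `s`. -/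
def mu (n d : ℕ) (s : ℝ) (H : Finset (Finset (Fin n))) : ℝ :=
  s ^ H.card * (1 - s) ^ ((dsets n d).card - H.card)

/-- Conditional mass function of the noisy projection `A` given the hypergraph `H`:
edges of `P(H)` kept with probability `p`, other pairs added with probability `q`. -/
def condP (n : ℕ) (p q : ℝ) (H A : Finset (Finset (Fin n))) : ℝ :=
  p ^ (A ∩ proj n H).card * (1 - p) ^ (proj n H \ A).card *
    q ^ (A \ proj n H).card * (1 - q) ^ ((pairs n \ proj n H) \ A).card

/-- Erdős–Rényi `G(n,q)` mass function. -/
def er (n : ℕ) (q : ℝ) (A : Finset (Finset (Fin n))) : ℝ :=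
  q ^ A.card * (1 - q) ^ ((pairs n).card - A.card)

/-- Joint planted mass function of `(H, A)` under `ℙ`. -/
def joint (n d : ℕ) (s p q : ℝ) (H A : Finset (Finset (Fin n))) : ℝ :=
  mu n d s H * condP n p q H A

/-- Marginal law of `A` under the planted measure `ℙ`. -/
def marg (n d : ℕ) (s p q : ℝ) (A : Finset (Finset (Fin n))) : ℝ :=
  ∑ H ∈ (dsets n d).powerset, joint n d s p q H A

/-- Probability of an event under the joint planted law `ℙ`. -/
def prJoint (n d : ℕ) (s p q : ℝ)
    (E : Finset (Finset (Fin n)) → Finset (Finset (Fin n)) → Prop) : ℝ :=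
  ∑ H ∈ (dsets n d).powerset, ∑ A ∈ (pairs n).powerset,
    if E H A then joint n d s p q H A else 0

/-- Probability of an event under the Erdős–Rényi law. -/
def prER (n : ℕ) (q : ℝ) (E : Finset (Finset (Fin n)) → Prop) : ℝ :=
  ∑ A ∈ (pairs n).powerset, if E A then er n q A else 0

/-- The clique estimator `Ĥ(A)`: all `d`-subsets of `[n]` that form a clique in `A`. -/
def cliqueEst (n d : ℕ) (A : Finset (Finset (Fin n))) : Finset (Finset (Fin n)) :=
  (dsets n d).filter fun Ψ => ∀ e ∈ pairs n, e ⊆ Ψ → e ∈ A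


lemma proj_subset_pairs (n : ℕ) (H : Finset (Finset (Fin n))) : proj n H ⊆ pairs n :=
  Finset.filter_subset _ _

/-- Edge weight given the projection. -/
def wt (n : ℕ) (p q : ℝ) (H : Finset (Finset (Fin n))) (e : Finset (Fin n)) : ℝ :=
  if e ∈ proj n H then p else q

lemma condP_eq (n : ℕ) (p q : ℝ) (H A : Finset (Finset (Fin n))) :
    condP n p q H A = (∏ e ∈ A, wt n p q H e) * ∏ e ∈ pairs n \ A, (1 - wt n p q H e) := by
  have h1 : ∀ e, 1 - wt n p q H e = if e ∈ proj n H then 1 - p else 1 - q := by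
    intro e; unfold wt; split_ifs <;> rfl
  simp only [h1]
  unfold wt condP
  rw [Finset.prod_ite, Finset.prod_ite]
  simp only [Finset.prod_const]
  have hP := proj_subset_pairs n H
  have e1 : A.filter (fun e => e ∈ proj n H) = A ∩ proj n H := by ext e; simp
  have e2 : A.filter (fun e => e ∉ proj n H) = A \ proj n H := by ext e; simp
  have e3 : (pairs n \ A).filter (fun e => e ∈ proj n H) = proj n H \ A := by
    ext e; simp only [Finset.mem_filter, Finset.mem_sdiff]
    constructor
    · tauto
    · rintro ⟨a, b⟩; exact ⟨⟨hP a, b⟩, a⟩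
  have e4 : (pairs n \ A).filter (fun e => e ∉ proj n H) = (pairs n \ proj n H) \ A := by
    ext e; simp only [Finset.mem_filter, Finset.mem_sdiff]; tauto
  rw [e1, e2, e3, e4]; ring

/-- General subset-sum identity with a superset constraint. -/
lemma sum_superset {α : Type*} [DecidableEq α] (P K : Finset α) (hK : K ⊆ P) (w : α → ℝ) :
    (∑ A ∈ P.powerset, if K ⊆ A then (∏ e ∈ A, w e) * ∏ e ∈ P \ A, (1 - w e) else 0)
      = ∏ e ∈ K, w e := by
  have h := Finset.prod_add w (fun e => if e ∈ K then 0 else 1 - w e) P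
  have h2 : ∏ e ∈ P, (w e + if e ∈ K then 0 else 1 - w e) = ∏ e ∈ K, w e := by
    rw [← Finset.prod_subset hK]
    · apply Finset.prod_congr rfl; intro e he; simp [he]
    · intro e _ he; simp [he]
  rw [← h2, h]
  apply Finset.sum_congr rfl
  intro A hA
  split_ifs with hKA
  · congr 1
    apply Finset.prod_congr rfl
    intro e he
    have : e ∉ K := fun hk => (Finset.mem_sdiff.1 he).2 (hKA hk)
    simp [this]
  · obtain ⟨e, heK, heA⟩ := Finset.not_subset.1 hKA
    rw [Finset.prod_eq_zero (i := e) (s := P \ A)]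
    · simp
    · exact Finset.mem_sdiff.2 ⟨hK heK, heA⟩
    · simp [heK]

/-- General subset-sum identity with an avoided element. -/
lemma sum_avoid {α : Type*} [DecidableEq α] (P : Finset α) (a : α) (ha : a ∈ P) (s : ℝ)
    (x : α → ℝ) :
    (∑ H ∈ P.powerset, if a ∉ H then
        (s ^ H.card * (1 - s) ^ (P.card - H.card)) * ∏ e ∈ H, x e else 0)
      = (1 - s) * ∏ e ∈ P.erase a, (s * x e + (1 - s)) := by
  have h := Finset.prod_add (fun e => if e = a then 0 else s * x e) (fun _ => 1 - s) P
  have h2 : ∏ e ∈ P, ((if e = a then 0 else s * x e) + (1 - s))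
      = (1 - s) * ∏ e ∈ P.erase a, (s * x e + (1 - s)) := by
    rw [← Finset.mul_prod_erase P _ ha]
    congr 1
    · simp
    · apply Finset.prod_congr rfl; intro e he; simp [Finset.ne_of_mem_erase he]
  rw [← h2, h]
  apply Finset.sum_congr rfl
  intro H hH
  rw [Finset.prod_const, Finset.card_sdiff_of_subset (Finset.mem_powerset.1 hH)]
  by_cases hKA : a ∉ H
  · rw [if_pos hKA]
    have : ∏ e ∈ H, (if e = a then 0 else s * x e) = ∏ e ∈ H, (s * x e) := by
      apply Finset.prod_congr rfl; intro e he
      rw [if_neg]; rintro rfl; exact hKA he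
    rw [this, Finset.prod_mul_distrib, Finset.prod_const]; ring
  · rw [if_neg hKA]
    rw [not_not] at hKA
    rw [Finset.prod_eq_zero hKA]
    · simp
    · simp

lemma wt_mem (n : ℕ) {p q : ℝ} (hp : 0 ≤ p ∧ p ≤ 1) (hq : 0 ≤ q ∧ q ≤ 1)
    (H : Finset (Finset (Fin n))) (e : Finset (Fin n)) :
    0 ≤ wt n p q H e ∧ wt n p q H e ≤ 1 := by
  unfold wt; split_ifs <;> assumption

lemma sum_condP (n : ℕ) (p q : ℝ) (H : Finset (Finset (Fin n))) :
    ∑ A ∈ (pairs n).powerset, condP n p q H A = 1 := by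
  have := sum_superset (pairs n) ∅ (Finset.empty_subset _) (wt n p q H)
  simpa [condP_eq] using this

lemma powersetCard_subset_pairs (n : ℕ) (Ψ : Finset (Fin n)) : Ψ.powersetCard 2 ⊆ pairs n :=
  Finset.powersetCard_mono (Finset.subset_univ _)

lemma mem_cliqueEst (n d : ℕ) (A : Finset (Finset (Fin n))) (Ψ : Finset (Fin n))
    (hΨ : Ψ ∈ dsets n d) : Ψ ∈ cliqueEst n d A ↔ Ψ.powersetCard 2 ⊆ A := by
  unfold cliqueEst pairs
  simp only [Finset.mem_filter, hΨ, true_and, Finset.subset_iff (s₁ := Ψ.powersetCard 2),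
    Finset.mem_powersetCard]
  constructor
  · intro h e he; exact h e ⟨Finset.subset_univ _, he.2⟩ he.1
  · intro h e he h2; exact h ⟨h2, he.2⟩

lemma sum_condP_clique (n d : ℕ) {p q t : ℝ} (hp : 0 ≤ p ∧ p ≤ 1) (hq : 0 ≤ q)
    (hqt : q ≤ t) (ht : 0 < t) (ht1 : t ≤ 1) (H : Finset (Finset (Fin n)))
    (Ψ : Finset (Fin n)) (hΨ : Ψ ∈ dsets n d) :
    (∑ A ∈ (pairs n).powerset, if Ψ ∈ cliqueEst n d A then condP n p q H A else 0)
      ≤ t ^ (d.choose 2) * ∏ Φ ∈ H, (t⁻¹) ^ ((Φ ∩ Ψ).card.choose 2) := by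
  have hcard : Ψ.card = d := (Finset.mem_powersetCard.1 hΨ).2
  simp only [mem_cliqueEst n d _ Ψ hΨ, condP_eq]
  have := sum_superset (pairs n) (Ψ.powersetCard 2) (powersetCard_subset_pairs n Ψ) (wt n p q H)
  rw [this]
  set K := Ψ.powersetCard 2 with hK
  have h1 : ∏ e ∈ K, wt n p q H e ≤ ∏ e ∈ K, (if e ∈ proj n H then 1 else t) := by
    apply Finset.prod_le_prod
    · intro e _; unfold wt; split_ifs; exacts [hp.1, hq]
    · intro e _; unfold wt; split_ifs; exacts [hp.2, hqt]
  refine h1.trans ?_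
  rw [Finset.prod_ite, Finset.prod_const_one, one_mul, Finset.prod_const]
  have hsplit := Finset.card_filter_add_card_filter_not (s := K) (fun e => e ∈ proj n H)
  have hKc : K.card = d.choose 2 := by rw [hK, Finset.card_powersetCard, hcard]
  have hcov : (K.filter (fun e => e ∈ proj n H)).card ≤ ∑ Φ ∈ H, (Φ ∩ Ψ).card.choose 2 := by
    have hsub : K.filter (fun e => e ∈ proj n H) ⊆ H.biUnion (fun Φ => (Φ ∩ Ψ).powersetCard 2) := by
      intro e he
      simp only [hK, proj, Finset.mem_filter, Finset.mem_powersetCard] at he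
      obtain ⟨⟨h1, h2⟩, _, Φ, hΦ, h3⟩ := he
      simp only [Finset.mem_biUnion, Finset.mem_powersetCard]
      exact ⟨Φ, hΦ, Finset.subset_inter h3 h1, h2⟩
    refine (Finset.card_le_card hsub).trans (Finset.card_biUnion_le.trans ?_)
    apply Finset.sum_le_sum; intro Φ _; rw [Finset.card_powersetCard]
  rw [Finset.prod_pow_eq_pow_sum]
  have hu : 1 ≤ t⁻¹ := (one_le_inv₀ ht).2 ht1
  rw [← hKc, ← hsplit]
  calc t ^ (K.filter (fun e => e ∉ proj n H)).card
      = t ^ ((K.filter (fun e => e ∈ proj n H)).card + (K.filter (fun e => e ∉ proj n H)).card)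
          * t⁻¹ ^ (K.filter (fun e => e ∈ proj n H)).card := by
        rw [pow_add, inv_pow]; field_simp
    _ ≤ _ := by
        apply mul_le_mul_of_nonneg_left (pow_le_pow_right₀ hu hcov) (by positivity)

lemma mu_nonneg (n d : ℕ) {s : ℝ} (hs : 0 < s ∧ s ≤ 1) (H : Finset (Finset (Fin n))) :
    0 ≤ mu n d s H := by
  unfold mu
  exact mul_nonneg (pow_nonneg hs.1.le _) (pow_nonneg (by linarith [hs.2]) _)

lemma denom_eq (n d : ℕ) (s p q : ℝ) (Ψ : Finset (Fin n)) (hΨ : Ψ ∈ dsets n d) :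
    prJoint n d s p q (fun H _A => Ψ ∉ H) = 1 - s := by
  have h := sum_avoid (dsets n d) Ψ hΨ s (fun _ => 1)
  simp only [Finset.prod_const_one, mul_one, add_sub_cancel] at h
  rw [← h]
  unfold prJoint joint
  apply Finset.sum_congr rfl
  intro H _
  by_cases h1 : Ψ ∉ H
  · simp only [h1, not_false_eq_true, if_true]
    rw [← Finset.mul_sum, sum_condP, mul_one]; rfl
  · simp [h1]

lemma numer_le (n d : ℕ) {s p q t : ℝ} (hs : 0 < s ∧ s ≤ 1) (hp : 0 ≤ p ∧ p ≤ 1) (hq : 0 ≤ q)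
    (hqt : q ≤ t) (ht : 0 < t) (ht1 : t ≤ 1)
    (Ψ : Finset (Fin n)) (hΨ : Ψ ∈ dsets n d) :
    prJoint n d s p q (fun H A => Ψ ∈ cliqueEst n d A ∧ Ψ ∉ H)
      ≤ t ^ (d.choose 2) * ((1 - s) * ∏ Φ ∈ (dsets n d).erase Ψ,
          (s * (t⁻¹) ^ ((Φ ∩ Ψ).card.choose 2) + (1 - s))) := by
  rw [← sum_avoid (dsets n d) Ψ hΨ s, Finset.mul_sum]
  unfold prJoint joint
  apply Finset.sum_le_sum
  intro H _
  by_cases h1 : Ψ ∉ H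
  · simp only [h1, not_false_eq_true, and_true, if_true]
    have := mul_le_mul_of_nonneg_left (sum_condP_clique n d hp hq hqt ht ht1 H Ψ hΨ)
      (mu_nonneg n d hs H)
    rw [Finset.mul_sum] at this
    calc _ = ∑ A ∈ (pairs n).powerset,
          mu n d s H * (if Ψ ∈ cliqueEst n d A then condP n p q H A else 0) := by
          apply Finset.sum_congr rfl; intro A _; split_ifs <;> simp
      _ ≤ _ := this
      _ = _ := by unfold mu; ring
  · simp [h1]

lemma count_le (n d k : ℕ) (hn : 1 ≤ n) (Ψ : Finset (Fin n)) (hΨ : Ψ ∈ dsets n d) :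
    ((dsets n d).filter (fun Φ => (Φ ∩ Ψ).card = k)).card ≤ 2 ^ d * n ^ (d - k) := by
  have hcard : Ψ.card = d := (Finset.mem_powersetCard.1 hΨ).2
  have : ((dsets n d).filter (fun Φ => (Φ ∩ Ψ).card = k)).card ≤
      (Ψ.powerset ×ˢ (Finset.univ : Finset (Fin n)).powersetCard (d - k)).card := by
    apply Finset.card_le_card_of_injOn (fun Φ => (Φ ∩ Ψ, Φ \ Ψ))
    · intro Φ hΦ
      simp only [dsets, Finset.coe_filter, Set.mem_setOf_eq, Finset.mem_powersetCard] at hΦ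
      simp only [Finset.coe_product, Set.mem_prod, Finset.mem_coe, Finset.mem_powerset,
        Finset.mem_powersetCard]
      refine ⟨Finset.inter_subset_right, Finset.subset_univ _, ?_⟩
      have := Finset.card_sdiff_add_card_inter Φ Ψ
      omega
    · intro Φ _ Φ' _ h
      simp only [Prod.mk.injEq] at h
      rw [← Finset.sdiff_union_inter Φ Ψ, ← Finset.sdiff_union_inter Φ' Ψ, h.1, h.2]
  refine this.trans ?_
  rw [Finset.card_product, Finset.card_powerset, hcard, Finset.card_powersetCard, Finset.card_univ,
    Fintype.card_fin]
  exact Nat.mul_le_mul_left _ (Nat.choose_le_pow n (d - k))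

lemma prod_le (n d : ℕ) (hn : 1 ≤ n) {s t : ℝ} (hs : 0 < s ∧ s ≤ 1)
    (ht : 0 < t) (ht1 : t ≤ 1)
    (hk : ∀ k ∈ Finset.Ico 2 d, s * (n : ℝ) ^ (d - k) * t⁻¹ ^ (k.choose 2) ≤ 1)
    (Ψ : Finset (Fin n)) (hΨ : Ψ ∈ dsets n d) :
    ∏ Φ ∈ (dsets n d).erase Ψ, (s * (t⁻¹) ^ ((Φ ∩ Ψ).card.choose 2) + (1 - s))
      ≤ Real.exp (d * 2 ^ d) := by
  have hcard : Ψ.card = d := (Finset.mem_powersetCard.1 hΨ).2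
  have hu : 1 ≤ t⁻¹ := (one_le_inv₀ ht).2 ht1
  have h1 : ∏ Φ ∈ (dsets n d).erase Ψ, (s * (t⁻¹) ^ ((Φ ∩ Ψ).card.choose 2) + (1 - s))
      ≤ ∏ Φ ∈ (dsets n d).erase Ψ, Real.exp (s * ((t⁻¹) ^ ((Φ ∩ Ψ).card.choose 2) - 1)) := by
    apply Finset.prod_le_prod
    · intro Φ _
      have : 0 ≤ s * t⁻¹ ^ ((Φ ∩ Ψ).card.choose 2) := by
        have := hs.1; positivity
      linarith [hs.2]
    · intro Φ _
      have := Real.add_one_le_exp (s * ((t⁻¹) ^ ((Φ ∩ Ψ).card.choose 2) - 1))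
      linarith
  refine h1.trans ?_
  rw [← Real.exp_sum]
  apply Real.exp_le_exp.2
  have hmaps : ∀ Φ ∈ (dsets n d).erase Ψ, (Φ ∩ Ψ).card ∈ Finset.range d := by
    intro Φ hΦ
    have hne := Finset.ne_of_mem_erase hΦ
    have hc : Φ.card = d := (Finset.mem_powersetCard.1 (Finset.mem_of_mem_erase hΦ)).2
    rw [Finset.mem_range]
    rcases lt_or_ge (Φ ∩ Ψ).card d with h | h
    · exact h
    · exfalso
      have e1 : Φ ∩ Ψ = Φ := Finset.eq_of_subset_of_card_le Finset.inter_subset_left (by omega)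
      have e2 : Φ ∩ Ψ = Ψ := Finset.eq_of_subset_of_card_le Finset.inter_subset_right (by omega)
      exact hne (e1.symm.trans e2)
  rw [← Finset.sum_fiberwise_of_maps_to hmaps]
  have : ∀ k ∈ Finset.range d, (∑ Φ ∈ (dsets n d).erase Ψ with (Φ ∩ Ψ).card = k,
      s * ((t⁻¹) ^ ((Φ ∩ Ψ).card.choose 2) - 1)) ≤ 2 ^ d := by
    intro k hkd
    have e : (∑ Φ ∈ (dsets n d).erase Ψ with (Φ ∩ Ψ).card = k,
      s * ((t⁻¹) ^ ((Φ ∩ Ψ).card.choose 2) - 1)) =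
      (∑ Φ ∈ (dsets n d).erase Ψ with (Φ ∩ Ψ).card = k, s * ((t⁻¹) ^ (k.choose 2) - 1)) := by
      apply Finset.sum_congr rfl
      intro Φ hΦ; rw [(Finset.mem_filter.1 hΦ).2]
    rw [e, Finset.sum_const, nsmul_eq_mul]
    rcases lt_or_ge k 2 with h2 | h2
    · rw [Nat.choose_eq_zero_of_lt h2]; simp
    · have hk' := hk k (Finset.mem_Ico.2 ⟨h2, Finset.mem_range.1 hkd⟩)
      have hc : (((dsets n d).erase Ψ).filter (fun Φ => (Φ ∩ Ψ).card = k)).card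
          ≤ 2 ^ d * n ^ (d - k) :=
        (Finset.card_le_card (Finset.filter_subset_filter _ (Finset.erase_subset _ _))).trans
          (count_le n d k hn Ψ hΨ)
      have hc' : ((((dsets n d).erase Ψ).filter (fun Φ => (Φ ∩ Ψ).card = k)).card : ℝ)
          ≤ 2 ^ d * (n : ℝ) ^ (d - k) := by exact_mod_cast hc
      have hpos : 0 ≤ s * t⁻¹ ^ (k.choose 2) := by have := hs.1; positivity
      calc _ ≤ ((((dsets n d).erase Ψ).filter (fun Φ => (Φ ∩ Ψ).card = k)).card : ℝ)
              * (s * t⁻¹ ^ (k.choose 2)) := by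
            apply mul_le_mul_of_nonneg_left _ (Nat.cast_nonneg _)
            nlinarith [hs.1]
        _ ≤ 2 ^ d * (n : ℝ) ^ (d - k) * (s * t⁻¹ ^ (k.choose 2)) :=
            mul_le_mul_of_nonneg_right hc' hpos
        _ = 2 ^ d * (s * (n : ℝ) ^ (d - k) * t⁻¹ ^ (k.choose 2)) := by ring
        _ ≤ 2 ^ d * 1 := by gcongr
        _ = 2 ^ d := mul_one _
  refine (Finset.sum_le_sum this).trans ?_
  simp

lemma prJoint_nonneg (n d : ℕ) {s p q : ℝ} (hs : 0 < s ∧ s ≤ 1) (hp : 0 ≤ p ∧ p ≤ 1)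
    (hq : 0 ≤ q ∧ q ≤ 1) (E : Finset (Finset (Fin n)) → Finset (Finset (Fin n)) → Prop) :
    0 ≤ prJoint n d s p q E := by
  unfold prJoint joint
  refine Finset.sum_nonneg fun H _ => Finset.sum_nonneg fun A _ => ?_
  split_ifs
  · refine mul_nonneg (mu_nonneg n d hs H) ?_
    have h1 : 0 ≤ 1 - p := by linarith [hp.2]
    have h2 : 0 ≤ 1 - q := by linarith [hq.2]
    have h3 := hp.1
    have h4 := hq.1
    unfold condP; positivity
  · exact le_rfl

/-- Finite-`n` bound. -/
lemma sup_le_bound (n d : ℕ) (hn : 1 ≤ n) {s p q t : ℝ} (hs : 0 < s ∧ s ≤ 1)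
    (hp : 0 ≤ p ∧ p ≤ 1) (hq : 0 ≤ q ∧ q ≤ 1) (hqt : q ≤ t) (ht : 0 < t) (ht1 : t ≤ 1)
    (hk : ∀ k ∈ Finset.Ico 2 d, s * (n : ℝ) ^ (d - k) * t⁻¹ ^ (k.choose 2) ≤ 1) :
    (⨆ Ψ ∈ dsets n d,
        prJoint n d s p q (fun H A => Ψ ∈ cliqueEst n d A ∧ Ψ ∉ H) /
          prJoint n d s p q (fun H _A => Ψ ∉ H)) ≤ t ^ (d.choose 2) * Real.exp (d * 2 ^ d) := by
  have hB : 0 ≤ t ^ (d.choose 2) * Real.exp (d * 2 ^ d) := by positivity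
  refine Real.iSup_le (fun Ψ => Real.iSup_le (fun hΨ => ?_) hB) hB
  rw [denom_eq n d s p q Ψ hΨ]
  have h1s : 0 ≤ 1 - s := by linarith [hs.2]
  refine div_le_of_le_mul₀ h1s hB ?_
  refine (numer_le n d hs hp hq.1 hqt ht ht1 Ψ hΨ).trans ?_
  have := prod_le n d hn hs ht ht1 hk Ψ hΨ
  calc _ ≤ t ^ (d.choose 2) * ((1 - s) * Real.exp (d * 2 ^ d)) := by gcongr
    _ = _ := by ring

/-- The exponent optimization. -/
lemma exists_gamma (d : ℕ) (hd : 2 ≤ d) (δ β : ℝ)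
    (hδ : 0 ≤ δ ∧ δ < ((d : ℝ) - 1) / ((d : ℝ) + 1))
    (hβ : 0 ≤ β ∧ β < 2 * δ / ((d : ℝ) * ((d : ℝ) - 1)) + ((d : ℝ) - 2) / (d : ℝ)) :
    ∃ γ : ℝ, 0 < γ ∧ (d : ℝ) - 1 - δ < γ * (d.choose 2 : ℕ) ∧ γ < 1 - β ∧
      ∀ k ∈ Finset.Ico 2 d, γ * (k.choose 2 : ℕ) < (k : ℝ) - 1 - δ := by
  have hD : (2 : ℝ) ≤ d := by exact_mod_cast hd
  have hδ2 : δ * (d + 1) < d - 1 := (lt_div_iff₀ (by linarith)).1 hδ.2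
  have hdd : 0 < (d : ℝ) * (d - 1) := by nlinarith
  have hδ1 : δ < 1 := by nlinarith [hδ.1]
  set g : ℝ := 2 * (d - 1 - δ) / (d * (d - 1)) with hg
  have hgpos : 0 < g := by rw [hg]; apply div_pos <;> linarith
  have hgβ : g < 1 - β := by
    have : g = 1 - (2 * δ / ((d : ℝ) * ((d : ℝ) - 1)) + ((d : ℝ) - 2) / (d : ℝ)) := by
      rw [hg]
      have h1 : (d : ℝ) ≠ 0 := by linarith
      have h2 : (d : ℝ) - 1 ≠ 0 := by linarith
      field_simp; ring
    rw [this]; linarith [hβ.2]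
  have hgk : ∀ k ∈ Finset.Ico 2 d, g * (k.choose 2 : ℕ) < (k : ℝ) - 1 - δ := by
    intro k hk
    obtain ⟨hk2, hkd⟩ := Finset.mem_Ico.1 hk
    have hK : (2 : ℝ) ≤ k := by exact_mod_cast hk2
    have hKd : (k : ℝ) + 1 ≤ d := by exact_mod_cast hkd
    rw [Nat.cast_choose_two, hg, div_mul_eq_mul_div, div_lt_iff₀ hdd]
    -- (d-1-δ) k (k-1) < (k-1-δ) d (d-1)
    have key : ((d : ℝ) - 1 - δ) * (k * (k - 1)) < (k - 1 - δ) * (d * (d - 1)) := by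
      have e : (k - 1 - δ) * ((d : ℝ) * (d - 1)) - ((d : ℝ) - 1 - δ) * (k * (k - 1))
        = (d - k) * ((d - 1) * (k - 1) - δ * (d + k - 1)) := by ring
      have : 0 < ((d : ℝ) - 1) * (k - 1) - δ * (d + k - 1) := by
        have h3 : δ * (d + 1) + δ * (k - 2) = δ * (d + k - 1) := by ring
        nlinarith [mul_nonneg (sub_nonneg.2 hK) hδ.1]
      nlinarith [mul_pos (show (0 : ℝ) < d - k by linarith) this]
    linarith
  have e1 : ∀ᶠ γ in nhdsWithin g (Set.Ioi g), γ < 1 - β :=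
    nhdsWithin_le_nhds (eventually_lt_nhds hgβ)
  have e2 : ∀ᶠ γ in nhdsWithin g (Set.Ioi g),
      ∀ k ∈ Finset.Ico 2 d, γ * (k.choose 2 : ℕ) < (k : ℝ) - 1 - δ := by
    rw [Filter.eventually_all_finset]
    intro k hk
    apply nhdsWithin_le_nhds
    exact (Continuous.tendsto (f := fun γ : ℝ => γ * (k.choose 2 : ℕ)) (by fun_prop) g).eventually
      (eventually_lt_nhds (hgk k hk))
  have e3 : ∀ᶠ γ in nhdsWithin g (Set.Ioi g), g < γ := self_mem_nhdsWithin
  obtain ⟨γ, h1, h2, h3⟩ := (e1.and (e2.and e3)).exists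
  refine ⟨γ, by linarith, ?_, h1, h2⟩
  rw [Nat.cast_choose_two]
  have : (d : ℝ) - 1 - δ = g * (d * (d - 1) / 2) := by
    rw [hg]
    have h1 : (d : ℝ) ≠ 0 := by linarith
    have h2 : (d : ℝ) - 1 ≠ 0 := by linarith
    field_simp
  rw [this]
  apply mul_lt_mul_of_pos_right h3; linarith

/-- for any noise level `p_n`, the false-positive probability of the clique
estimator, maximized over `d`-subsets `Ψ`, is `o(s_n)`. -/
theorem clique_estimator_false_positive
    (d : ℕ) (hd : 2 ≤ d) (δ β : ℝ)
    (hδ : 0 ≤ δ ∧ δ < ((d : ℝ) - 1) / ((d : ℝ) + 1))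
    (hβ : 0 ≤ β ∧ β < 2 * δ / ((d : ℝ) * ((d : ℝ) - 1)) + ((d : ℝ) - 2) / (d : ℝ))
    (s q : ℕ → ℝ)
    (hs01 : ∀ n, 0 < s n ∧ s n ≤ 1)
    (hq01 : ∀ n, 0 ≤ q n ∧ q n ≤ 1)
    (hs : Tendsto (fun n : ℕ => Real.log (s n) / Real.log n) atTop
      (nhds (-((d : ℝ) - 1) + δ)))
    (hq : Tendsto (fun n : ℕ => Real.log (q n) / Real.log n) atTop (nhds (-1 + β))) :
    ∀ p : ℕ → ℝ, (∀ n, 0 ≤ p n ∧ p n ≤ 1) → (∀ n, q n ≤ p n) →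
      Tendsto (fun n : ℕ =>
          (⨆ Ψ ∈ dsets n d,
            prJoint n d (s n) (p n) (q n) (fun H A => Ψ ∈ cliqueEst n d A ∧ Ψ ∉ H) /
              prJoint n d (s n) (p n) (q n) (fun H _A => Ψ ∉ H)) / s n)
        atTop (nhds 0) := by
  intro p hp _hpq
  obtain ⟨γ, hγ0, hγd, hγβ, hγk⟩ := exists_gamma d hd δ β hδ hβ
  have hL : Tendsto (fun n : ℕ => Real.log n) atTop atTop :=
    Real.tendsto_log_atTop.comp tendsto_natCast_atTop_atTop
  have hlim : Tendsto (fun n : ℕ => Real.exp (Real.log n *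
      (-(γ * (d.choose 2 : ℕ)) - Real.log (s n) / Real.log n)) * Real.exp (d * 2 ^ d))
      atTop (nhds 0) := by
    rw [show (0 : ℝ) = 0 * Real.exp (d * 2 ^ d) by simp]
    apply Tendsto.mul_const
    apply Real.tendsto_exp_atBot.comp
    refine hL.atTop_mul_neg (C := -(γ * (d.choose 2 : ℕ)) - (-((d : ℝ) - 1) + δ)) (by linarith) ?_
    exact tendsto_const_nhds.sub hs
  have evk : ∀ᶠ n : ℕ in atTop, ∀ k ∈ Finset.Ico 2 d,
      Real.log (s n) / Real.log n < -((d : ℝ) - k) - γ * (k.choose 2 : ℕ) := by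
    rw [Filter.eventually_all_finset]
    intro k hk
    have := hγk k hk
    exact hs.eventually (eventually_lt_nhds (by linarith))
  have evq : ∀ᶠ n : ℕ in atTop, Real.log (q n) / Real.log n < -γ :=
    hq.eventually (eventually_lt_nhds (by linarith))
  refine tendsto_of_tendsto_of_tendsto_of_le_of_le' tendsto_const_nhds hlim ?_ ?_
  · refine Eventually.of_forall fun n => ?_
    refine div_nonneg (Real.iSup_nonneg fun Ψ => Real.iSup_nonneg fun _ => ?_) (hs01 n).1.le
    exact div_nonneg (prJoint_nonneg n d (hs01 n) (hp n) (hq01 n) _)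
      (prJoint_nonneg n d (hs01 n) (hp n) (hq01 n) _)
  · filter_upwards [evk, evq, hL.eventually_gt_atTop 0, eventually_ge_atTop 1] with n hk hqn hl hn
    have hnpos : (0 : ℝ) < n := by exact_mod_cast hn
    set L := Real.log n with hLdef
    have hsn : s n = Real.exp (L * (Real.log (s n) / L)) := by
      rw [mul_div_cancel₀ _ hl.ne', Real.exp_log (hs01 n).1]
    have hnL : (n : ℝ) = Real.exp L := (Real.exp_log hnpos).symm
    have hqt : q n ≤ Real.exp (-(γ * L)) := by
      rcases (hq01 n).1.eq_or_lt with h | h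
      · rw [← h]; positivity
      · rw [← Real.exp_log h]
        apply Real.exp_le_exp.2
        have := (div_lt_iff₀ hl).1 hqn
        linarith
    have ht1 : Real.exp (-(γ * L)) ≤ 1 := Real.exp_le_one_iff.2 (by nlinarith)
    have hb := sup_le_bound n d hn (hs01 n) (hp n) (hq01 n) hqt (Real.exp_pos _) ht1 (by
      intro k hk'
      have h1 := hk k hk'
      have hkd := (Finset.mem_Ico.1 hk').2
      generalize Real.log (s n) / L = σ at h1 hsn
      rw [hsn, hnL, ← Real.exp_neg, ← Real.exp_nat_mul, ← Real.exp_nat_mul, ← Real.exp_add,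
        ← Real.exp_add, Real.exp_le_one_iff, Nat.cast_sub hkd.le]
      nlinarith [mul_pos hl (sub_pos.2 h1)])
    refine (div_le_div_of_nonneg_right hb (hs01 n).1.le).trans (le_of_eq ?_)
    rw [mul_div_right_comm]
    congr 1
    generalize Real.log (s n) / L = σ at hsn
    rw [hsn, ← Real.exp_nat_mul, ← Real.exp_sub]
    congr 1; ring

end NoisyHypergraph
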